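/- arXiv:1604.02622 — 3 statements merged into one kernel-verified Lean document; each statement's English description precedes it below -/
import Mathlib

section
/- Define γ_n ∈ (ℤ/2)[t] for odd n > 0 by γ₁ = 0, γ₃ = 0, γ₅ = t³, γ₇ = t⁵, and γ_{n+8} = t⁸·γ_n + t²·γ_{n+2}. Then for every odd n > 0, γ_n is a sum of monomials t^m with m odd and with code strictly preceding the code of t^n. -/
open Polynomial

/-- `(c,d)` strictly precedes `(a,b)` in the Nicolas–Serre order. -/
def prec (c d a b : ℕ) : Prop := c + d < a + b ∨ (c + d = a + b ∧ d < b)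

/-- Initial data (bitmasks of polynomials over F_2) of the finitely many sequences that occur. -/
def initTab : List (List ℕ) :=
  [[0, 0, 2, 4], [0, 0, 0, 2], [0, 0, 1, 2], [0, 1, 0, 4], [1, 2, 4, 10], [0, 0, 2, 0], [0, 0, 1, 0], [0, 1, 0, 6], [1, 2, 6, 14], [0, 1, 1, 4], [1, 3, 6, 10], [0, 2, 2, 8], [1, 0, 6, 2], [0, 1, 2, 0], [0, 0, 0, 0]]

/-- Transition table: row = state, column = 4 r + s. -/
def transTab : List (List ℕ) :=
  [[14, 1, 14, 2, 0, 14, 3, 14, 14, 4, 14, 3, 5, 14, 4, 14],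
   [1, 14, 14, 14, 14, 14, 14, 2, 14, 14, 3, 14, 14, 4, 14, 14],
   [1, 14, 2, 14, 14, 3, 14, 2, 4, 14, 3, 14, 14, 4, 14, 6],
   [14, 7, 14, 14, 8, 14, 14, 14, 14, 14, 14, 9, 14, 14, 10, 14],
   [8, 14, 7, 14, 14, 8, 14, 9, 11, 14, 10, 14, 14, 12, 14, 10],
   [14, 14, 14, 2, 14, 14, 3, 14, 14, 4, 14, 14, 5, 14, 14, 14],
   [14, 14, 2, 14, 14, 3, 14, 14, 4, 14, 14, 14, 14, 14, 14, 6],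
   [1, 7, 14, 14, 8, 14, 14, 2, 14, 14, 3, 9, 14, 4, 10, 14],
   [8, 1, 7, 2, 0, 8, 3, 9, 11, 4, 10, 3, 5, 12, 4, 10],
   [14, 7, 2, 14, 8, 3, 14, 14, 4, 14, 14, 9, 14, 14, 10, 6],
   [8, 3, 7, 2, 4, 8, 3, 9, 11, 4, 10, 6, 5, 12, 13, 10],
   [14, 14, 7, 2, 14, 8, 3, 14, 11, 4, 14, 14, 5, 14, 14, 10],
   [8, 14, 14, 2, 14, 14, 3, 9, 14, 4, 10, 14, 5, 12, 14, 14],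
   [14, 3, 14, 2, 4, 14, 3, 14, 14, 4, 14, 6, 5, 14, 13, 14],
   [14, 14, 14, 14, 14, 14, 14, 14, 14, 14, 14, 14, 14, 14, 14, 14]]

/-- Weight bounds. -/
def thTab : List ℤ := [0, -1, -1, -1, 0, 1, -1, -1, 0, -1, 0, 0, 0, 0, 0]

/-- Bounds on the second coordinate in case of equal weight (none = no condition). -/
def phTab : List (Option ℤ) :=
  [some (-1), none, some (-1), none, some (0), some (0), none, none, some (0), none, some (0), none, none, none, none]

/-- The sequences, as bitmasks. -/
def seqN (i : ℕ) : ℕ → ℕ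
  | 0 => (initTab.getD i []).getD 0 0
  | 1 => (initTab.getD i []).getD 1 0
  | 2 => (initTab.getD i []).getD 2 0
  | 3 => (initTab.getD i []).getD 3 0
  | k + 4 => (seqN i k <<< 4) ^^^ (seqN i (k + 1) <<< 1)

def dlt (i r s : ℕ) : ℕ := (transTab.getD i []).getD (4 * r + s) 14

def thv (i : ℕ) : ℤ := thTab.getD i 0
def phv (i : ℕ) : Option ℤ := phTab.getD i none

theorem seqN_rec (i k : ℕ) : seqN i (k + 4) = (seqN i k <<< 4) ^^^ (seqN i (k + 1) <<< 1) := by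
  rw [seqN]

theorem xor_cancel_mid (a b c : ℕ) : (a ^^^ b) ^^^ (b ^^^ c) = a ^^^ c := by
  rw [Nat.xor_assoc, ← Nat.xor_assoc b b c, Nat.xor_self, Nat.zero_xor]

theorem seqN_rec8 (i k : ℕ) :
    seqN i (k + 8) = (seqN i k <<< 8) ^^^ (seqN i (k + 2) <<< 2) := by
  rw [seqN_rec i (k + 4), seqN_rec i k, show k + 4 + 1 = k + 1 + 4 by ring, seqN_rec i (k + 1)]
  simp only [Nat.shiftLeft_xor_distrib, ← Nat.shiftLeft_add, Nat.reduceAdd]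
  rw [xor_cancel_mid]

theorem seqN_rec16 (i k : ℕ) :
    seqN i (k + 16) = (seqN i k <<< 16) ^^^ (seqN i (k + 4) <<< 4) := by
  rw [seqN_rec8 i (k + 8), seqN_rec8 i k, show k + 8 + 2 = k + 2 + 8 by ring, seqN_rec8 i (k + 2)]
  simp only [Nat.shiftLeft_xor_distrib, ← Nat.shiftLeft_add, Nat.reduceAdd]
  rw [xor_cancel_mid]

theorem base_small : ∀ i < 15, ∀ r < 4, ∀ s < 4, ∀ j < 4, ∀ m < 10,
    (seqN i (4 * j + r)).testBit (4 * m + s) = (seqN (dlt i r s) j).testBit m := by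
  decide +kernel

theorem base_big : ∀ i < 15, (∀ k < 16, seqN i k < 2 ^ 40) ∧ (∀ k < 4, seqN i k < 2 ^ 10) := by
  decide +kernel

theorem dlt_lt : ∀ i < 15, ∀ r < 4, ∀ s < 4, dlt i r s < 15 := by
  decide +kernel

theorem section_eq (i r s : ℕ) (hi : i < 15) (hr : r < 4) (hs : s < 4) :
    ∀ k m, (seqN i (4 * k + r)).testBit (4 * m + s) = (seqN (dlt i r s) k).testBit m := by
  intro k
  induction k using Nat.strong_induction_on with
  | _ k ih =>
    intro m
    by_cases hk : k < 4
    · by_cases hm : m < 10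
      · exact base_small i hi r hr s hs k hk m hm
      · rw [Nat.testBit_eq_false_of_lt, Nat.testBit_eq_false_of_lt]
        · exact lt_of_lt_of_le ((base_big _ (dlt_lt i hi r hr s hs)).2 k hk)
            (Nat.pow_le_pow_right (by norm_num) (by omega))
        · exact lt_of_lt_of_le ((base_big i hi).1 (4 * k + r) (by omega))
            (Nat.pow_le_pow_right (by norm_num) (by omega))
    · obtain ⟨k, rfl⟩ : ∃ l, k = l + 4 := ⟨k - 4, by omega⟩
      have a1 := ih k (by omega) (m - 4)
      have a2 := ih (k + 1) (by omega) (m - 1)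
      rw [show 4 * (k + 4) + r = (4 * k + r) + 16 by ring, seqN_rec16, seqN_rec (dlt i r s) k]
      simp only [Nat.testBit_xor, Nat.testBit_shiftLeft]
      rw [← a1, ← a2, show 4 * (k + 1) + r = 4 * k + r + 4 by ring]
      congr 1
      · by_cases h : 4 ≤ m
        · rw [show 4 * m + s - 16 = 4 * (m - 4) + s by omega]
          simp [h, show 16 ≤ 4 * m + s by omega]
        · simp [h, show ¬ 16 ≤ 4 * m + s by omega]
      · by_cases h : 1 ≤ m
        · rw [show 4 * m + s - 4 = 4 * (m - 1) + s by omega]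
          simp [h, show 4 ≤ 4 * m + s by omega]
        · simp [h, show ¬ 4 ≤ 4 * m + s by omega]

/-- Lexicographic bound attached to a state. -/
def bnd (i : ℕ) (w v : ℤ) : Prop := w < thv i ∨ (w = thv i ∧ ∀ p ∈ phv i, v ≤ p)

/-- Compatibility of the bounds of two states along a transition. -/
def transOK (i j r0 r1 s0 s1 : ℕ) : Prop :=
  j = 14 ∨ 2 * thv j + ((s0 : ℤ) + s1 - r0 - r1) < thv i ∨
    (2 * thv j + ((s0 : ℤ) + s1 - r0 - r1) = thv i ∧
      (phv i = none ∨ (phv j).isSome = true ∧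
        2 * (phv j).getD 0 + ((s1 : ℤ) - r1) ≤ (phv i).getD 0))

instance (i j r0 r1 s0 s1 : ℕ) : Decidable (transOK i j r0 r1 s0 s1) := by
  unfold transOK
  infer_instance

theorem trans_ok : ∀ i < 15, ∀ r0 < 2, ∀ r1 < 2, ∀ s0 < 2, ∀ s1 < 2,
    transOK i (dlt i (r0 + 2 * r1) (s0 + 2 * s1)) r0 r1 s0 s1 := by
  decide +kernel

theorem term_ok : ∀ i < 15, (seqN i 0).testBit 0 = true →
    0 < thv i ∨ (thv i = 0 ∧ 0 ≤ (phv i).getD 0) := by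
  decide +kernel

theorem zero_state : ∀ k, seqN 14 k = 0 := by
  intro k
  induction k using Nat.strong_induction_on with
  | _ k ih =>
    match k with
    | 0 => rfl
    | 1 => rfl
    | 2 => rfl
    | 3 => rfl
    | k + 4 => rw [seqN_rec, ih k (by omega), ih (k + 1) (by omega)]; rfl

theorem g_split (g : ℕ → ℕ) (hge : ∀ n, g (2 * n) = 4 * g n)
    (hgo : ∀ n, g (2 * n + 1) = g (2 * n) + 1) (n : ℕ) :
    g n = 4 * g (n / 2) + n % 2 := by
  rcases Nat.mod_two_eq_zero_or_one n with h | h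
  · have := hge (n / 2)
    rw [show 2 * (n / 2) = n by omega] at this
    omega
  · have := hgo (n / 2)
    rw [hge, show 2 * (n / 2) + 1 = n by omega] at this
    omega

theorem main_bound (g : ℕ → ℕ) (hg0 : g 0 = 0) (hge : ∀ n, g (2 * n) = 4 * g n)
    (hgo : ∀ n, g (2 * n + 1) = g (2 * n) + 1) :
    ∀ N a b c d i, a + b + c + d ≤ N → i < 15 →
      (seqN i (g a + 2 * g b)).testBit (g c + 2 * g d) = true →
      bnd i ((c : ℤ) + d - a - b) ((d : ℤ) - b) := by
  intro N
  induction N with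
  | zero =>
    intro a b c d i hN hi h
    obtain ⟨rfl, rfl, rfl, rfl⟩ : a = 0 ∧ b = 0 ∧ c = 0 ∧ d = 0 := by omega
    simp only [hg0] at h
    rcases term_ok i hi h with h | ⟨h, h'⟩
    · left; simpa using h
    · right
      refine ⟨by simp [h], ?_⟩
      intro p hp
      rw [Option.mem_def] at hp
      rw [hp] at h'
      simpa using h'
  | succ N ih =>
    intro a b c d i hN hi h
    by_cases hz : a + b + c + d ≤ N
    · exact ih a b c d i hz hi h
    have ea := g_split g hge hgo a
    have eb := g_split g hge hgo b
    have ec := g_split g hge hgo c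
    have ed := g_split g hge hgo d
    have ra : a % 2 < 2 := Nat.mod_lt _ (by norm_num)
    have rb : b % 2 < 2 := Nat.mod_lt _ (by norm_num)
    have rc : c % 2 < 2 := Nat.mod_lt _ (by norm_num)
    have rd : d % 2 < 2 := Nat.mod_lt _ (by norm_num)
    rw [show g a + 2 * g b = 4 * (g (a / 2) + 2 * g (b / 2)) + (a % 2 + 2 * (b % 2)) by omega,
      show g c + 2 * g d = 4 * (g (c / 2) + 2 * g (d / 2)) + (c % 2 + 2 * (d % 2)) by omega,
      section_eq i _ _ hi (by omega) (by omega)] at h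
    have hd := dlt_lt i hi (a % 2 + 2 * (b % 2)) (by omega) (c % 2 + 2 * (d % 2)) (by omega)
    have hb := ih _ _ _ _ _ (by omega) hd h
    have ht := trans_ok i hi _ ra _ rb _ rc _ rd
    generalize dlt i (a % 2 + 2 * (b % 2)) (c % 2 + 2 * (d % 2)) = i' at *
    unfold transOK at ht
    rcases ht with rfl | ht
    · rw [zero_state] at h
      simp at h
    unfold bnd at hb ⊢
    rcases hb with hb | ⟨hb, hv⟩
    · left; omega
    · rcases ht with ht | ⟨ht, hp | ⟨hs, hp⟩⟩
      · left; omega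
      · right
        refine ⟨by omega, ?_⟩
        simp [hp]
      · right
        refine ⟨by omega, ?_⟩
        obtain ⟨q, hq⟩ := Option.isSome_iff_exists.mp hs
        intro p hpp
        rw [Option.mem_def] at hpp
        rw [hpp, hq] at hp
        simp only [Option.getD_some] at hp
        have := hv q hq
        omega

theorem g_surj (g : ℕ → ℕ) (hg0 : g 0 = 0) (hge : ∀ n, g (2 * n) = 4 * g n)
    (hgo : ∀ n, g (2 * n + 1) = g (2 * n) + 1) :
    ∀ m, ∃ c d, m = g c + 2 * g d := by
  intro m
  induction m using Nat.strong_induction_on with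
  | _ m ih =>
    by_cases hm : m = 0
    · exact ⟨0, 0, by simp [hg0, hm]⟩
    obtain ⟨c, d, h⟩ := ih (m / 4) (by omega)
    refine ⟨2 * c + m % 2, 2 * d + m / 2 % 2, ?_⟩
    have e1 := g_split g hge hgo (2 * c + m % 2)
    have e2 := g_split g hge hgo (2 * d + m / 2 % 2)
    rw [show (2 * c + m % 2) / 2 = c by omega] at e1
    rw [show (2 * d + m / 2 % 2) / 2 = d by omega] at e2
    omega

theorem coeff_link (γ : ℕ → Polynomial (ZMod 2))
    (h1 : γ 1 = 0) (h3 : γ 3 = 0) (h5 : γ 5 = X ^ 3) (h7 : γ 7 = X ^ 5)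
    (hrec : ∀ n, Odd n → γ (n + 8) = X ^ 8 * γ n + X ^ 2 * γ (n + 2)) :
    ∀ k m, (γ (2 * k + 1)).coeff m =
      if m % 2 = 1 ∧ (seqN 0 k).testBit (m / 2) = true then 1 else 0 := by
  intro k
  induction k using Nat.strong_induction_on with
  | _ k ih =>
    intro m
    match k with
    | 0 => simp [h1, seqN, initTab]
    | 1 => simp [h3, seqN, initTab]
    | 2 =>
      simp only [h5, seqN, initTab, coeff_X_pow, Nat.reduceMul, Nat.reduceAdd]
      refine if_congr ?_ rfl rfl
      simp only [List.getD_cons_zero, List.getD_cons_succ]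
      rw [show (2 : ℕ) = 2 ^ 1 by rfl, Nat.testBit_two_pow, decide_eq_true_eq]
      omega
    | 3 =>
      simp only [h7, seqN, initTab, coeff_X_pow, Nat.reduceMul, Nat.reduceAdd]
      refine if_congr ?_ rfl rfl
      simp only [List.getD_cons_zero, List.getD_cons_succ]
      rw [show (4 : ℕ) = 2 ^ 2 by rfl, Nat.testBit_two_pow, decide_eq_true_eq]
      omega
    | k + 4 =>
      rw [show 2 * (k + 4) + 1 = (2 * k + 1) + 8 by ring, hrec _ ⟨k, rfl⟩, seqN_rec, coeff_add,
        coeff_X_pow_mul', coeff_X_pow_mul', ih k (by omega),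
        show 2 * k + 1 + 2 = 2 * (k + 1) + 1 by ring, ih (k + 1) (by omega)]
      simp only [Nat.testBit_xor, Nat.testBit_shiftLeft]
      rw [show (m - 8) / 2 = m / 2 - 4 by omega, show (m - 2) / 2 = m / 2 - 1 by omega]
      generalize (seqN 0 k).testBit (m / 2 - 4) = p
      generalize (seqN 0 (k + 1)).testBit (m / 2 - 1) = q
      have t1 : (4 ≤ m / 2) ↔ 8 ≤ m := by omega
      have t2 : (1 ≤ m / 2) ↔ 2 ≤ m := by omega
      simp only [ge_iff_le, t1, t2]
      have two : (1 : ZMod 2) + 1 = 0 := by decide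
      by_cases c8 : 8 ≤ m
      · have c2 : 2 ≤ m := by omega
        have u1 : (m - 8) % 2 = m % 2 := by omega
        have u2 : (m - 2) % 2 = m % 2 := by omega
        rw [u1, u2]
        by_cases o : m % 2 = 1 <;> cases p <;> cases q <;> simp [c8, c2, o, two]
      · by_cases c2 : 2 ≤ m
        · have u2 : (m - 2) % 2 = m % 2 := by omega
          rw [u2]
          by_cases o : m % 2 = 1 <;> cases p <;> cases q <;> simp [c8, c2, o]
        · simp [c8, c2]

theorem stmt_10 (g : ℕ → ℕ) (hg0 : g 0 = 0)
    (hge : ∀ n, g (2 * n) = 4 * g n)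
    (hgo : ∀ n, g (2 * n + 1) = g (2 * n) + 1)
    (γ : ℕ → Polynomial (ZMod 2))
    (h1 : γ 1 = 0) (h3 : γ 3 = 0) (h5 : γ 5 = X ^ 3) (h7 : γ 7 = X ^ 5)
    (hrec : ∀ n, Odd n → γ (n + 8) = X ^ 8 * γ n + X ^ 2 * γ (n + 2)) :
    ∀ n, Odd n → 0 < n → ∀ a b, n = 1 + 2 * g a + 4 * g b →
      ∀ m, (γ n).coeff m ≠ 0 → ∃ c d, m = 1 + 2 * g c + 4 * g d ∧ prec c d a b := by
  intro n _ _ a b hn m hm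
  rw [show n = 2 * (g a + 2 * g b) + 1 by omega, coeff_link γ h1 h3 h5 h7 hrec] at hm
  have hm' : m % 2 = 1 ∧ (seqN 0 (g a + 2 * g b)).testBit (m / 2) = true := by
    by_contra hcon
    exact hm (if_neg hcon)
  obtain ⟨hodd, ht⟩ := hm'
  obtain ⟨c, d, hcd⟩ := g_surj g hg0 hge hgo (m / 2)
  refine ⟨c, d, by omega, ?_⟩
  rw [hcd] at ht
  have hb := main_bound g hg0 hge hgo _ a b c d 0 le_rfl (by norm_num) ht
  have e1 : thv 0 = 0 := rfl
  have e2 : phv 0 = some (-1) := rfl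
  unfold bnd at hb
  rw [e1, e2] at hb
  unfold prec
  rcases hb with hb | ⟨hb, hv⟩
  · left; omega
  · right
    have := hv (-1) rfl
    omega
end

section
/- Define β_n ∈ (ℤ/2)[t] for odd n > 0 by β₁ = t, β₃ = t³, β₅ = t⁵, β₇ = t⁷ + t³, and β_{n+8} = t⁸·β_n + t²·β_{n+2}. Then for all odd n > 0, β_n = t^n + (a sum of monomials whose codes strictly precede the code of t^n). -/
open Polynomial

/-- First component of the code of `2 * n + 1`. -/
def codeC (n : ℕ) : ℕ := if h : n = 0 then 0 else 2 * codeC (n / 4) + n % 2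
termination_by n
decreasing_by omega

/-- Second component of the code of `2 * n + 1`. -/
def codeD (n : ℕ) : ℕ := if h : n = 0 then 0 else 2 * codeD (n / 4) + n % 4 / 2
termination_by n
decreasing_by omega

lemma codeC_rec (n r : ℕ) (hr : r < 4) : codeC (4 * n + r) = 2 * codeC n + r % 2 := by
  rcases Nat.eq_zero_or_pos (4 * n + r) with h | h
  · have h1 : n = 0 := by omega
    have h2 : r = 0 := by omega
    subst h1; subst h2
    simp [codeC]
  · rw [codeC, dif_neg (by omega)]
    have h1 : (4 * n + r) / 4 = n := by omega
    rw [h1]; omega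

lemma codeD_rec (n r : ℕ) (hr : r < 4) : codeD (4 * n + r) = 2 * codeD n + r / 2 := by
  rcases Nat.eq_zero_or_pos (4 * n + r) with h | h
  · have h1 : n = 0 := by omega
    have h2 : r = 0 := by omega
    subst h1; subst h2
    simp [codeD]
  · rw [codeD, dif_neg (by omega)]
    have h1 : (4 * n + r) / 4 = n := by omega
    rw [h1]; omega

/-- Increment of `c + d` when the bit `i` is added. -/
def incH : ℕ → ℕ
  | 0 => 1
  | 1 => 1
  | (i + 2) => 2 * incH i

/-- Increment of `d` when the bit `i` is added. -/
def incD : ℕ → ℕ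
  | 0 => 0
  | 1 => 1
  | (i + 2) => 2 * incD i

/-- Effect on codes of adding `2 ^ i`. -/
def AddSpec (i j : ℕ) : Prop :=
  (j / 2 ^ i % 2 = 0 ∧ codeC (j + 2 ^ i) + codeD (j + 2 ^ i) = codeC j + codeD j + incH i ∧
    codeD (j + 2 ^ i) = codeD j + incD i) ∨
  (j / 2 ^ i % 2 = 1 ∧ (codeC (j + 2 ^ i) + codeD (j + 2 ^ i) < codeC j + codeD j + incH i ∨
    (codeC (j + 2 ^ i) + codeD (j + 2 ^ i) = codeC j + codeD j + incH i ∧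
    codeD (j + 2 ^ i) < codeD j + incD i)))

lemma addSpec_zero (j : ℕ) : AddSpec 0 j := by
  induction j using Nat.strong_induction_on with
  | _ j ih =>
    obtain ⟨n, r, hr, rfl⟩ : ∃ n r, r < 4 ∧ j = 4 * n + r :=
      ⟨j / 4, j % 4, by omega, by omega⟩
    have e1 := codeC_rec n r hr
    have e2 := codeD_rec n r hr
    by_cases h3 : r = 3
    · subst h3
      have hn := ih n (by omega)
      have e3 := codeC_rec (n + 1) 0 (by omega)
      have e4 := codeD_rec (n + 1) 0 (by omega)
      have e5 : 4 * n + 3 + 1 = 4 * (n + 1) + 0 := by ring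
      simp only [AddSpec, pow_zero, incH, incD, Nat.div_one] at hn ⊢
      rw [e5]
      omega
    · have e3 := codeC_rec n (r + 1) (by omega)
      have e4 := codeD_rec n (r + 1) (by omega)
      simp only [AddSpec, pow_zero, incH, incD, Nat.div_one]
      rw [add_assoc]
      omega

lemma addSpec_one (j : ℕ) : AddSpec 1 j := by
  obtain ⟨n, r, hr, rfl⟩ : ∃ n r, r < 4 ∧ j = 4 * n + r :=
    ⟨j / 4, j % 4, by omega, by omega⟩
  have e1 := codeC_rec n r hr
  have e2 := codeD_rec n r hr
  by_cases h3 : 2 ≤ r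
  · have hn := addSpec_zero n
    have e3 := codeC_rec (n + 1) (r - 2) (by omega)
    have e4 := codeD_rec (n + 1) (r - 2) (by omega)
    have e5 : 4 * n + r + 2 = 4 * (n + 1) + (r - 2) := by omega
    simp only [AddSpec, pow_zero, pow_one, incH, incD, Nat.div_one] at hn ⊢
    rw [e5]
    omega
  · have e3 := codeC_rec n (r + 2) (by omega)
    have e4 := codeD_rec n (r + 2) (by omega)
    simp only [AddSpec, pow_one, incH, incD]
    rw [add_assoc]
    omega

lemma addSpec : ∀ i j : ℕ, AddSpec i j
  | 0, j => addSpec_zero j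
  | 1, j => addSpec_one j
  | (i + 2), j => by
    obtain ⟨n, r, hr, rfl⟩ : ∃ n r, r < 4 ∧ j = 4 * n + r :=
      ⟨j / 4, j % 4, by omega, by omega⟩
    have hn := addSpec i n
    have e1 := codeC_rec n r hr
    have e2 := codeD_rec n r hr
    have e3 := codeC_rec (n + 2 ^ i) r hr
    have e4 := codeD_rec (n + 2 ^ i) r hr
    have e5 : 4 * n + r + 2 ^ (i + 2) = 4 * (n + 2 ^ i) + r := by ring
    have e6 : (4 * n + r) / 2 ^ (i + 2) = n / 2 ^ i := by
      rw [show 2 ^ (i + 2) = 4 * 2 ^ i by ring, ← Nat.div_div_eq_div_mul]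
      congr 1
      omega
    simp only [AddSpec, incH, incD] at hn ⊢
    rw [e5, e6]
    omega

/-- Strict order on indices through their codes. -/
def lowIdx (j k : ℕ) : Prop := prec (codeC j) (codeD j) (codeC k) (codeD k)

lemma g_code (g : ℕ → ℕ) (hg0 : g 0 = 0) (hge : ∀ n, g (2 * n) = 4 * g n)
    (hgo : ∀ n, g (2 * n + 1) = g (2 * n) + 1) (k : ℕ) :
    k = g (codeC k) + 2 * g (codeD k) := by
  have key : ∀ n e, e < 2 → g (2 * n + e) = 4 * g n + e := by
    intro n e he
    interval_cases e
    · simpa using hge n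
    · rw [hgo, hge]
  induction k using Nat.strong_induction_on with
  | _ k ih =>
    rcases Nat.eq_zero_or_pos k with h | h
    · subst h; simp [codeC, codeD, hg0]
    · have h1 := ih (k / 4) (by omega)
      have e1 := codeC_rec (k / 4) (k % 4) (by omega)
      have e2 := codeD_rec (k / 4) (k % 4) (by omega)
      have e3 : 4 * (k / 4) + k % 4 = k := by omega
      rw [e3] at e1 e2
      rw [e1, e2, key _ _ (by omega), key _ _ (by omega)]
      omega

lemma code_g (g : ℕ → ℕ) (hg0 : g 0 = 0) (hge : ∀ n, g (2 * n) = 4 * g n)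
    (hgo : ∀ n, g (2 * n + 1) = g (2 * n) + 1) (s : ℕ) : ∀ a b, a + b = s →
    codeC (g a + 2 * g b) = a ∧ codeD (g a + 2 * g b) = b := by
  have key : ∀ n, g n = 4 * g (n / 2) + n % 2 := by
    intro n
    rcases Nat.mod_two_eq_zero_or_one n with h | h
    · have := hge (n / 2)
      rw [show 2 * (n / 2) = n by omega] at this
      omega
    · have h1 := hge (n / 2)
      have h2 := hgo (n / 2)
      rw [show 2 * (n / 2) + 1 = n by omega] at h2
      omega
  induction s using Nat.strong_induction_on with
  | _ s ih =>
    intro a b hs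
    rcases Nat.eq_zero_or_pos s with h | h
    · have ha : a = 0 := by omega
      have hb : b = 0 := by omega
      subst ha; subst hb
      simp [codeC, codeD, hg0]
    · have h1 := ih (a / 2 + b / 2) (by omega) (a / 2) (b / 2) rfl
      have e : g a + 2 * g b = 4 * (g (a / 2) + 2 * g (b / 2)) + (a % 2 + 2 * (b % 2)) := by
        have := key a
        have := key b
        omega
      rw [e, codeC_rec _ _ (by omega), codeD_rec _ _ (by omega), h1.1, h1.2]
      omega

/-- All monomials of `f` have index strictly below `k`. -/
def Low (k : ℕ) (f : Polynomial (ZMod 2)) : Prop :=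
  ∀ m, f.coeff m ≠ 0 → ∃ j, m = 2 * j + 1 ∧ lowIdx j k

lemma Low.add {k : ℕ} {f h : Polynomial (ZMod 2)} (hf : Low k f) (hh : Low k h) :
    Low k (f + h) := by
  intro m hm
  by_cases h1 : f.coeff m = 0
  · exact hh m (by intro h2; apply hm; simp [h1, h2])
  · exact hf m h1

lemma low_X {k j : ℕ} (h : lowIdx j k) : Low k (X ^ (2 * j + 1)) := by
  intro m hm
  rw [coeff_X_pow] at hm
  refine ⟨j, ?_, h⟩
  by_contra h1
  simp [h1] at hm

lemma Low.shift {k l s : ℕ} {f : Polynomial (ZMod 2)} (hf : Low k f)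
    (H : ∀ j, lowIdx j k → lowIdx (j + s) l) : Low l (X ^ (2 * s) * f) := by
  intro m hm
  rw [coeff_X_pow_mul'] at hm
  split_ifs at hm with h
  · obtain ⟨j, h1, h2⟩ := hf _ hm
    exact ⟨j + s, by omega, H j h2⟩
  · exact absurd rfl hm

lemma rec_pow (β : ℕ → Polynomial (ZMod 2))
    (hrec : ∀ n, Odd n → β (n + 8) = X ^ 8 * β n + X ^ 2 * β (n + 2)) (i : ℕ) :
    ∀ n, Odd n → β (n + 8 * 2 ^ i) =
      X ^ (8 * 2 ^ i) * β n + X ^ (2 * 2 ^ i) * β (n + 2 * 2 ^ i) := by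
  induction i with
  | zero => simpa using hrec
  | succ i ih =>
    intro n hn
    have a1 := ih n hn
    have a2 := ih (n + 8 * 2 ^ i) (hn.add_even ⟨4 * 2 ^ i, by ring⟩)
    have a3 := ih (n + 2 * 2 ^ i) (hn.add_even ⟨2 ^ i, by ring⟩)
    rw [show n + 8 * 2 ^ (i + 1) = n + 8 * 2 ^ i + 8 * 2 ^ i by ring, a2, a1,
      show n + 8 * 2 ^ i + 2 * 2 ^ i = n + 2 * 2 ^ i + 8 * 2 ^ i by ring, a3,
      show n + 2 * 2 ^ (i + 1) = n + 2 * 2 ^ i + 2 * 2 ^ i by ring]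
    generalize β (n + 2 * 2 ^ i) = u
    generalize β (n + 2 * 2 ^ i + 2 * 2 ^ i) = v
    generalize β n = w
    rw [pow_succ 2 i]
    generalize 2 ^ i = P
    have hz : X ^ (10 * P) * u + X ^ (10 * P) * u = 0 := CharTwo.add_self_eq_zero _
    linear_combination hz

lemma lowIdx_first (i k j : ℕ) (hk : k / 2 ^ i % 2 = 0) (h : lowIdx j k) :
    lowIdx (j + 2 ^ i) (k + 2 ^ i) := by
  have h1 := addSpec i k
  have h2 := addSpec i j
  simp only [AddSpec, lowIdx, prec] at *
  omega

lemma lowIdx_second (i k j : ℕ) (hk : k / 2 ^ (i + 2) % 2 = 0)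
    (h : lowIdx j (k + 2 ^ i)) : lowIdx (j + 2 ^ i) (k + 2 ^ (i + 2)) := by
  have h1 := addSpec (i + 2) k
  have h2 := addSpec i j
  have h3 := addSpec i k
  simp only [AddSpec, lowIdx, prec, incH, incD] at *
  omega

lemma lowIdx_second' (i k : ℕ) (hk : k / 2 ^ (i + 2) % 2 = 0) :
    lowIdx (k + 2 ^ i + 2 ^ i) (k + 2 ^ (i + 2)) := by
  have h1 := addSpec (i + 2) k
  have h2 := addSpec i (k + 2 ^ i)
  have h3 := addSpec i k
  have h4 : (k + 2 ^ i) / 2 ^ i = k / 2 ^ i + 1 := Nat.add_div_right _ (by positivity)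
  simp only [AddSpec, lowIdx, prec, incH, incD] at *
  rw [h4] at h2
  omega

lemma main_low (β : ℕ → Polynomial (ZMod 2))
    (h1 : β 1 = X) (h3 : β 3 = X ^ 3) (h5 : β 5 = X ^ 5) (h7 : β 7 = X ^ 7 + X ^ 3)
    (hrec : ∀ n, Odd n → β (n + 8) = X ^ 8 * β n + X ^ 2 * β (n + 2)) (k : ℕ) :
    ∃ B, β (2 * k + 1) = X ^ (2 * k + 1) + B ∧ Low k B := by
  have low0 : ∀ k, Low k 0 := fun k m hm => absurd (coeff_zero m) hm
  induction k using Nat.strong_induction_on with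
  | _ k ih =>
    by_cases hk : k < 4
    · interval_cases k
      · exact ⟨0, by simp [h1], low0 _⟩
      · exact ⟨0, by simp [h3], low0 _⟩
      · exact ⟨0, by simp [h5], low0 _⟩
      · refine ⟨X ^ 3, by simp [h7], low_X (j := 1) ?_⟩
        simp [lowIdx, prec, codeC, codeD]
    · obtain ⟨i, hi⟩ : ∃ i, Nat.log 2 k = i + 2 := by
        have : 2 ≤ Nat.log 2 k := Nat.le_log_of_pow_le (by norm_num) (by omega)
        exact ⟨Nat.log 2 k - 2, by omega⟩
      have b1 : 2 ^ (i + 2) ≤ k := hi ▸ Nat.pow_log_le_self 2 (by omega)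
      have b2 : k < 2 ^ (i + 2 + 1) := hi ▸ Nat.lt_pow_succ_log_self (by norm_num) k
      obtain ⟨l, rfl⟩ := Nat.exists_eq_add_of_le' b1
      have hl : l / 2 ^ (i + 2) % 2 = 0 := by
        rw [Nat.div_eq_of_lt (by have := pow_succ 2 (i + 2); omega)]
      have e4 : 2 ^ (i + 2) = 4 * 2 ^ i := by ring
      have hp : 0 < 2 ^ i := by positivity
      obtain ⟨B1, hB1, L1⟩ := ih l (by omega)
      obtain ⟨B2, hB2, L2⟩ := ih (l + 2 ^ i) (by omega)
      have hr := rec_pow β hrec i (2 * l + 1) ⟨l, rfl⟩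
      rw [show 2 * l + 1 + 8 * 2 ^ i = 2 * (l + 2 ^ (i + 2)) + 1 by ring,
        show 2 * l + 1 + 2 * 2 ^ i = 2 * (l + 2 ^ i) + 1 by ring, hB1, hB2,
        show 8 * 2 ^ i = 2 * 2 ^ (i + 2) by ring] at hr
      refine ⟨X ^ (2 * 2 ^ (i + 2)) * B1 + (X ^ (2 * (l + 2 ^ i + 2 ^ i) + 1) +
        X ^ (2 * 2 ^ i) * B2), ?_, ?_⟩
      · rw [hr]; ring
      · exact (L1.shift fun j hj => lowIdx_first _ _ _ hl hj).add
          ((low_X (lowIdx_second' _ _ hl)).add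
            (L2.shift fun j hj => lowIdx_second _ _ _ hl hj))

theorem stmt_12 (g : ℕ → ℕ) (hg0 : g 0 = 0)
    (hge : ∀ n, g (2 * n) = 4 * g n)
    (hgo : ∀ n, g (2 * n + 1) = g (2 * n) + 1)
    (β : ℕ → Polynomial (ZMod 2))
    (h1 : β 1 = X) (h3 : β 3 = X ^ 3) (h5 : β 5 = X ^ 5) (h7 : β 7 = X ^ 7 + X ^ 3)
    (hrec : ∀ n, Odd n → β (n + 8) = X ^ 8 * β n + X ^ 2 * β (n + 2)) :
    ∀ n, Odd n → 0 < n → ∀ a b, n = 1 + 2 * g a + 4 * g b →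
      ∃ B : Polynomial (ZMod 2), β n = X ^ n + B ∧
        ∀ m, B.coeff m ≠ 0 → ∃ c d, m = 1 + 2 * g c + 4 * g d ∧ prec c d a b := by
  intro n _ _ a b hn
  obtain ⟨B, hB, L⟩ := main_low β h1 h3 h5 h7 hrec (g a + 2 * g b)
  have e : n = 2 * (g a + 2 * g b) + 1 := by omega
  rw [← e] at hB
  refine ⟨B, hB, fun m hm => ?_⟩
  obtain ⟨j, hj, hl⟩ := L m hm
  obtain ⟨ea, eb⟩ := code_g g hg0 hge hgo _ a b rfl
  rw [lowIdx, ea, eb] at hl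
  refine ⟨codeC j, codeD j, ?_, hl⟩
  have := g_code g hg0 hge hgo j
  omega
end

section
/- Define A_n ∈ (ℤ/2)[t] for odd n > 0 by A₁=0, A₃=t, A₅=0, A₇=t⁵, A₉=t³, A₁₁=t⁹+t, A₁₃=t⁷, A₁₅=t¹³+t⁵, and A_{n+16} = t¹⁶·A_n + t⁴·A_{n+4} + t²·A_{n+2}. Write the code of t^n as (a,b). If a > 0, then A_n = t^{1+2g(a−1)+4g(b)} + (a sum of monomials with code strictly preceding (a−1,b)). If a = 0, then A_n is a sum of monomials with code equal to or strictly preceding (0, b−1). -/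
open Polynomial

namespace NS

/-- Even-position binary digits of `N`. -/
def e (N : ℕ) : ℕ := if h : N = 0 then 0 else 2 * e (N / 4) + N % 2
termination_by N
decreasing_by omega

theorem e_eq (N : ℕ) : e N = 2 * e (N / 4) + N % 2 := by
  by_cases h : N = 0
  · subst h; simp [e]
  · rw [e]; simp [h]

/-- Odd-position binary digits of `N`. -/
def d (N : ℕ) : ℕ := e (N / 2)

theorem d_eq (N : ℕ) : d N = 2 * d (N / 4) + (N / 2) % 2 := by
  unfold d
  rw [e_eq]
  have : N / 2 / 4 = N / 4 / 2 := by omega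
  rw [this]

theorem e_zero : e 0 = 0 := by simp [e]
theorem d_zero : d 0 = 0 := by simp [d, e]

theorem sub_aux (B : ℕ) : ∀ N M δ : ℕ, N + M ≤ B → δ ≤ 1 →
    e (N + M + δ) + d (N + M + δ) < e N + d N + (e M + d M) + δ ∨
    (e (N + M + δ) + d (N + M + δ) = e N + d N + (e M + d M) + δ ∧
      d (N + M + δ) ≤ d N + d M) := by
  induction B using Nat.strong_induction_on with
  | _ B ih =>
    intro N M δ hB hδ
    by_cases h0 : N + M = 0
    · have hN : N = 0 := by omega
      have hM : M = 0 := by omega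
      subst hN hM
      have h1 := e_eq 1
      have h2 := d_eq 1
      norm_num [e_zero, d_zero] at h1 h2
      interval_cases δ <;> simp [e_zero, d_zero, h1, h2]
    · have hd : (N % 4 + M % 4 + δ) / 4 ≤ 1 := by omega
      have := ih (N / 4 + M / 4) (by omega) (N / 4) (M / 4) ((N % 4 + M % 4 + δ) / 4) le_rfl hd
      have hq : N / 4 + M / 4 + (N % 4 + M % 4 + δ) / 4 = (N + M + δ) / 4 := by omega
      rw [hq] at this
      have a1 := e_eq N
      have a2 := e_eq M
      have a3 := e_eq (N + M + δ)
      have b1 := d_eq N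
      have b2 := d_eq M
      have b3 := d_eq (N + M + δ)
      have hr : N % 4 < 4 := by omega
      have hs : M % 4 < 4 := by omega
      have c1 : N % 2 = N % 4 % 2 := by omega
      have c2 : M % 2 = M % 4 % 2 := by omega
      have c3 : (N + M + δ) % 2 = (N % 4 + M % 4 + δ) % 2 := by omega
      have d1 : N / 2 % 2 = N % 4 / 2 := by omega
      have d2 : M / 2 % 2 = M % 4 / 2 := by omega
      have d3 : (N + M + δ) / 2 % 2 = (N % 4 + M % 4 + δ) / 2 % 2 := by omega
      rw [c1] at a1
      rw [c2] at a2
      rw [c3] at a3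
      rw [d1] at b1
      rw [d2] at b2
      rw [d3] at b3
      generalize N % 4 = r at *
      generalize M % 4 = s at *
      generalize (N + M + δ) / 4 = Q at *
      generalize e (N + M + δ) = x1 at *
      generalize d (N + M + δ) = x2 at *
      clear c1 c2 c3 d1 d2 d3 ih hq
      interval_cases δ <;> interval_cases r <;> interval_cases s <;> norm_num at * <;> omega

theorem sub (N M : ℕ) :
    e (N + M) + d (N + M) < e N + d N + (e M + d M) ∨
    (e (N + M) + d (N + M) = e N + d N + (e M + d M) ∧ d (N + M) ≤ d N + d M) :=
  sub_aux (N + M) N M 0 le_rfl (by omega)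

theorem e_lt (K : ℕ) : ∀ N, N < 4 ^ K → e N < 2 ^ K := by
  induction K with
  | zero => intro N h; have : N = 0 := by simpa using h
            subst this; simp [e_zero]
  | succ K ih =>
    intro N h
    have := ih (N / 4) (by rw [pow_succ] at h; omega)
    rw [e_eq, pow_succ]; omega

section G
variable (g : ℕ → ℕ) (hg0 : g 0 = 0) (hge : ∀ n, g (2 * n) = 4 * g n)
    (hgo : ∀ n, g (2 * n + 1) = g (2 * n) + 1)

theorem g_eq (hge : ∀ n, g (2 * n) = 4 * g n)
    (hgo : ∀ n, g (2 * n + 1) = g (2 * n) + 1) (n : ℕ) : g n = 4 * g (n / 2) + n % 2 := by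
  rcases Nat.even_or_odd' n with ⟨k, rfl | rfl⟩
  · rw [hge]; simp
  · rw [hgo, hge]
    have : (2 * k + 1) / 2 = k := by omega
    rw [this]; omega

theorem g_mono (hge : ∀ n, g (2 * n) = 4 * g n)
    (hgo : ∀ n, g (2 * n + 1) = g (2 * n) + 1) (x : ℕ) : g x + 1 ≤ g (x + 1) := by
  induction x using Nat.strong_induction_on with
  | _ x ih =>
    have y1 := g_eq g hge hgo x
    have y2 := g_eq g hge hgo (x + 1)
    by_cases hx : x % 2 = 0
    · have : (x + 1) / 2 = x / 2 := by omega
      rw [this] at y2; omega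
    · have h1 : (x + 1) / 2 = x / 2 + 1 := by omega
      rw [h1] at y2
      have := ih (x / 2) (by omega)
      omega

theorem g_pow_add (hg0 : g 0 = 0) (hge : ∀ n, g (2 * n) = 4 * g n)
    (hgo : ∀ n, g (2 * n + 1) = g (2 * n) + 1) (k : ℕ) :
    ∀ x, x < 2 ^ k → g (2 ^ k + x) = 4 ^ k + g x := by
  induction k with
  | zero =>
    intro x h
    have : x = 0 := by simpa using h
    subst this
    have := hgo 0
    simp [hg0] at this ⊢; exact this
  | succ k ih =>
    intro x h
    rw [pow_succ] at h
    have := ih (x / 2) (by omega)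
    rw [g_eq g hge hgo, g_eq g hge hgo x, pow_succ, pow_succ]
    have h1 : (2 ^ k * 2 + x) / 2 = 2 ^ k + x / 2 := by omega
    rw [h1, this]; omega

theorem g_pow (hg0 : g 0 = 0) (hge : ∀ n, g (2 * n) = 4 * g n)
    (hgo : ∀ n, g (2 * n + 1) = g (2 * n) + 1) (k : ℕ) : g (2 ^ k) = 4 ^ k := by
  have := g_pow_add g hg0 hge hgo k 0 (by positivity)
  simpa [hg0] using this

theorem G1 (hg0 : g 0 = 0) (hge : ∀ n, g (2 * n) = 4 * g n)
    (hgo : ∀ n, g (2 * n + 1) = g (2 * n) + 1) (N : ℕ) : N = g (e N) + 2 * g (d N) := by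
  induction N using Nat.strong_induction_on with
  | _ N ih =>
    by_cases h : N = 0
    · subst h; simp [e_zero, d_zero, hg0]
    · have := ih (N / 4) (by omega)
      rw [e_eq, d_eq, g_eq g hge hgo (2 * e (N / 4) + N % 2),
        g_eq g hge hgo (2 * d (N / 4) + N / 2 % 2)]
      have h1 : (2 * e (N / 4) + N % 2) / 2 = e (N / 4) := by omega
      have h2 : (2 * d (N / 4) + N / 2 % 2) / 2 = d (N / 4) := by omega
      rw [h1, h2]
      omega

theorem G2 (hg0 : g 0 = 0) (hge : ∀ n, g (2 * n) = 4 * g n)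
    (hgo : ∀ n, g (2 * n + 1) = g (2 * n) + 1) (B : ℕ) : ∀ a b, a + b ≤ B →
    e (g a + 2 * g b) = a ∧ d (g a + 2 * g b) = b := by
  induction B using Nat.strong_induction_on with
  | _ B ih =>
    intro a b hB
    by_cases h : a + b = 0
    · have ha : a = 0 := by omega
      have hb : b = 0 := by omega
      subst ha hb; simp [e_zero, d_zero, hg0]
    · obtain ⟨h1, h2⟩ := ih (a / 2 + b / 2) (by omega) (a / 2) (b / 2) le_rfl
      have e1 := g_eq g hge hgo a
      have e2 := g_eq g hge hgo b
      have h3 : (g a + 2 * g b) / 4 = g (a / 2) + 2 * g (b / 2) := by omega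
      rw [e_eq, d_eq, h3, h1, h2]
      omega

theorem e_g (hg0 : g 0 = 0) (hge : ∀ n, g (2 * n) = 4 * g n)
    (hgo : ∀ n, g (2 * n + 1) = g (2 * n) + 1) (a b : ℕ) : e (g a + 2 * g b) = a :=
  (G2 g hg0 hge hgo _ a b le_rfl).1

theorem d_g (hg0 : g 0 = 0) (hge : ∀ n, g (2 * n) = 4 * g n)
    (hgo : ∀ n, g (2 * n + 1) = g (2 * n) + 1) (a b : ℕ) : d (g a + 2 * g b) = b :=
  (G2 g hg0 hge hgo _ a b le_rfl).2

/-- No-carry contradiction. -/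
theorem carry (hg0 : g 0 = 0) (hge : ∀ n, g (2 * n) = 4 * g n)
    (hgo : ∀ n, g (2 * n + 1) = g (2 * n) + 1) (k x y : ℕ) (hyx : y ≤ x) (hx : x < 2 * 2 ^ k)
    (h1 : g (x + 2 ^ k) = g x + 4 ^ k)
    (h2 : g (y + 2 * 2 ^ k) = g (y + 2 ^ k) + 4 ^ k) : False := by
  have hp : 0 < 4 ^ k := by positivity
  have e2 : 2 * 2 ^ k = 2 ^ (k + 1) := by ring
  have e4 : 4 * 4 ^ k = 4 ^ (k + 1) := by ring
  by_cases hxw : x < 2 ^ k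
  · have a1 := g_pow_add g hg0 hge hgo k y (by omega)
    have a2 := g_pow_add g hg0 hge hgo (k + 1) y (by omega)
    rw [← e2, ← e4, add_comm (2 * 2 ^ k) y] at a2
    rw [add_comm (2 ^ k) y] at a1
    omega
  · obtain ⟨z, rfl⟩ : ∃ z, x = 2 ^ k + z := ⟨x - 2 ^ k, by omega⟩
    have a1 := g_pow_add g hg0 hge hgo k z (by omega)
    have a2 := g_pow_add g hg0 hge hgo (k + 1) z (by omega)
    rw [← e2, ← e4] at a2
    have : 2 ^ k + z + 2 ^ k = 2 * 2 ^ k + z := by ring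
    rw [this] at h1
    omega

end G

theorem e_pow (k : ℕ) : e (4 ^ k) = 2 ^ k ∧ d (4 ^ k) = 0 := by
  induction k with
  | zero => rw [e_eq, d_eq]; simp [e_zero, d_zero]
  | succ k ih =>
    have : 4 ^ (k + 1) / 4 = 4 ^ k := by rw [pow_succ]; omega
    rw [e_eq, d_eq, this, ih.1, ih.2, pow_succ, pow_succ]
    omega

theorem e_two_pow (k : ℕ) : e (2 * 4 ^ k) = 0 ∧ d (2 * 4 ^ k) = 2 ^ k := by
  induction k with
  | zero => rw [e_eq, d_eq]; simp [e_zero, d_zero]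
  | succ k ih =>
    have : 2 * 4 ^ (k + 1) / 4 = 2 * 4 ^ k := by rw [pow_succ]; omega
    rw [e_eq, d_eq, this, ih.1, ih.2, pow_succ, pow_succ]
    omega

theorem frob (P : ℕ → Polynomial (ZMod 2))
    (hrec : ∀ n, P (n + 8) = X ^ 8 * P n + X ^ 2 * P (n + 2) + X * P (n + 1)) (j : ℕ) :
    ∀ n, P (n + 8 * 2 ^ j) = X ^ (8 * 2 ^ j) * P n + X ^ (2 * 2 ^ j) * P (n + 2 * 2 ^ j)
      + X ^ (2 ^ j) * P (n + 2 ^ j) := by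
  induction j with
  | zero => intro n; simpa using hrec n
  | succ j ih =>
    intro n
    have hp : 2 ^ (j + 1) = 2 * 2 ^ j := by ring
    rw [hp]
    generalize 2 ^ j = q at *
    have h2 : (2 : Polynomial (ZMod 2)) = 0 := CharTwo.two_eq_zero
    have e0 := ih (n + 8 * q)
    have e1 := ih n
    have e2 := ih (n + 2 * q)
    have e3 := ih (n + q)
    have s0 : n + 8 * (2 * q) = n + 8 * q + 8 * q := by ring
    have s1 : n + 8 * q + 2 * q = n + 2 * q + 8 * q := by ring
    have s2 : n + 8 * q + q = n + q + 8 * q := by ring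
    have s3 : n + 2 * q + q = n + 3 * q := by ring
    have s4 : n + q + 2 * q = n + 3 * q := by ring
    have s5 : n + q + q = n + 2 * q := by ring
    have s6 : n + 2 * q + 2 * q = n + 2 * (2 * q) := by ring
    rw [s0, e0, s1, s2, e1, e2, e3, s3, s4, s5, s6]
    linear_combination (X ^ (10 * q) * P (n + 2 * q) + X ^ (9 * q) * P (n + q)
      + X ^ (3 * q) * P (n + 3 * q)) * h2

/-- The upper-bound relation `v(m) + (1,0) ≤ v(N)`. -/
def U (m N : ℕ) : Prop :=
  e m + d m + 1 < e N + d N ∨ (e m + d m + 1 = e N + d N ∧ d m ≤ d N)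

theorem top (N : ℕ) (h : 8 ≤ N) : ∃ j N', N = N' + 8 * 2 ^ j ∧ N' < 8 * 2 ^ j := by
  have hN : N / 8 ≠ 0 := by omega
  have h1 := Nat.pow_log_le_self 2 hN
  have h2 := Nat.lt_pow_succ_log_self (b := 2) (by norm_num) (N / 8)
  rw [Nat.succ_eq_add_one, pow_succ] at h2
  refine ⟨Nat.log 2 (N / 8), N - 8 * 2 ^ Nat.log 2 (N / 8), ?_, ?_⟩ <;> omega

/-- Codes of `q`, `2q`, `8q` in the two parity cases, with no-carry for the top bit. -/
theorem codes (j : ℕ) : ∃ k,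
    (2 ^ j = 4 ^ k ∧ e (2 ^ j) = 2 ^ k ∧ d (2 ^ j) = 0 ∧ e (2 * 2 ^ j) = 0 ∧ d (2 * 2 ^ j) = 2 ^ k ∧
      e (8 * 2 ^ j) = 0 ∧ d (8 * 2 ^ j) = 2 * 2 ^ k) ∨
    (2 ^ j = 2 * 4 ^ k ∧ e (2 ^ j) = 0 ∧ d (2 ^ j) = 2 ^ k ∧ e (2 * 2 ^ j) = 2 * 2 ^ k ∧
      d (2 * 2 ^ j) = 0 ∧ e (8 * 2 ^ j) = 4 * 2 ^ k ∧ d (8 * 2 ^ j) = 0) := by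
  rcases Nat.even_or_odd' j with ⟨k, rfl | rfl⟩
  · refine ⟨k, Or.inl ?_⟩
    have h : 2 ^ (2 * k) = 4 ^ k := by rw [pow_mul]; norm_num
    have h8 : 8 * 4 ^ k = 2 * 4 ^ (k + 1) := by ring
    have h2 : 2 * 2 ^ k = 2 ^ (k + 1) := by ring
    rw [h, h8, h2]
    exact ⟨rfl, (e_pow k).1, (e_pow k).2, (e_two_pow k).1, (e_two_pow k).2,
      (e_two_pow (k + 1)).1, (e_two_pow (k + 1)).2⟩
  · refine ⟨k, Or.inr ?_⟩
    have h : 2 ^ (2 * k + 1) = 2 * 4 ^ k := by rw [pow_succ, pow_mul]; norm_num; ring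
    have h4 : 2 * (2 * 4 ^ k) = 4 ^ (k + 1) := by ring
    have h8 : 8 * (2 * 4 ^ k) = 4 ^ (k + 2) := by ring
    have h2 : 2 * 2 ^ k = 2 ^ (k + 1) := by ring
    have h3 : 4 * 2 ^ k = 2 ^ (k + 2) := by ring
    rw [h, h4, h8, h2, h3]
    exact ⟨rfl, (e_two_pow k).1, (e_two_pow k).2, (e_pow (k + 1)).1, (e_pow (k + 1)).2,
      (e_pow (k + 2)).1, (e_pow (k + 2)).2⟩

theorem cf (k n : ℕ) (f : Polynomial (ZMod 2)) (h : (X ^ k * f).coeff n ≠ 0) :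
    ∃ m, n = m + k ∧ f.coeff m ≠ 0 := by
  rw [coeff_X_pow_mul'] at h
  split_ifs at h with hk
  · exact ⟨n - k, by omega, h⟩
  · exact absurd rfl h

theorem g_nocarry (g : ℕ → ℕ) (hg0 : g 0 = 0) (hge : ∀ n, g (2 * n) = 4 * g n)
    (hgo : ∀ n, g (2 * n + 1) = g (2 * n) + 1) (j N' : ℕ) (h : N' < 8 * 2 ^ j) :
    e (N' + 8 * 2 ^ j) = e N' + e (8 * 2 ^ j) ∧ d (N' + 8 * 2 ^ j) = d N' + d (8 * 2 ^ j) := by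
  have hN := G1 g hg0 hge hgo N'
  obtain ⟨k, ⟨hq, -, -, -, -, h5, h6⟩ | ⟨hq, -, -, -, -, h5, h6⟩⟩ := codes j
  · rw [h5, h6]
    have h8 : 8 * 2 ^ j = 2 * 4 ^ (k + 1) := by rw [hq]; ring
    have hb : d N' < 2 ^ (k + 1) := e_lt _ _ (by omega)
    have h9 := g_pow_add g hg0 hge hgo (k + 1) (d N') hb
    have h10 : N' + 8 * 2 ^ j = g (e N') + 2 * g (2 ^ (k + 1) + d N') := by omega
    rw [h10, e_g g hg0 hge hgo, d_g g hg0 hge hgo]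
    exact ⟨rfl, by ring⟩
  · rw [h5, h6]
    have h8 : 8 * 2 ^ j = 4 ^ (k + 2) := by rw [hq]; ring
    have hb : e N' < 2 ^ (k + 2) := e_lt _ _ (by omega)
    have h9 := g_pow_add g hg0 hge hgo (k + 2) (e N') hb
    have h10 : N' + 8 * 2 ^ j = g (2 ^ (k + 2) + e N') + 2 * g (d N') := by omega
    rw [h10, e_g g hg0 hge hgo, d_g g hg0 hge hgo]
    exact ⟨by ring, rfl⟩

theorem small : (e 1 = 1 ∧ d 1 = 0) ∧ (e 2 = 0 ∧ d 2 = 1) ∧ (e 3 = 1 ∧ d 3 = 1) ∧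
    (e 4 = 2 ∧ d 4 = 0) ∧ (e 5 = 3 ∧ d 5 = 0) ∧ (e 6 = 2 ∧ d 6 = 1) ∧ (e 7 = 3 ∧ d 7 = 1) := by
  simp [e, d]

theorem upper (g : ℕ → ℕ) (hg0 : g 0 = 0) (hge : ∀ n, g (2 * n) = 4 * g n)
    (hgo : ∀ n, g (2 * n + 1) = g (2 * n) + 1) (P : ℕ → Polynomial (ZMod 2))
    (p0 : P 0 = 0) (p1 : P 1 = 1) (p2 : P 2 = 0) (p3 : P 3 = X ^ 2) (p4 : P 4 = X)
    (p5 : P 5 = X ^ 4 + 1) (p6 : P 6 = X ^ 3) (p7 : P 7 = X ^ 6 + X ^ 2)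
    (hrec : ∀ n, P (n + 8) = X ^ 8 * P n + X ^ 2 * P (n + 2) + X * P (n + 1)) (N : ℕ) :
    ∀ m, (P N).coeff m ≠ 0 → U m N := by
  induction N using Nat.strong_induction_on with
  | _ N ih =>
    intro m hm
    by_cases h8 : N < 8
    · obtain ⟨s1, s2, s3, s4, s5, s6, s7⟩ := small
      have z1 := e_zero
      have z2 := d_zero
      unfold U
      interval_cases N
      · simp [p0] at hm
      · have : m = 0 := by
          by_contra h; simp [p1, coeff_one, h] at hm
        subst this; omega
      · simp [p2] at hm
      · have : m = 2 := by
          by_contra h; simp [p3, coeff_X_pow, h] at hm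
        subst this; omega
      · have : m = 1 := by
          by_contra h; simp [p4, coeff_X, Ne.symm h] at hm
        subst this; omega
      · have : m = 4 ∨ m = 0 := by
          by_contra! h; simp [p5, coeff_X_pow, coeff_one, h.1, h.2] at hm
        rcases this with rfl | rfl <;> omega
      · have : m = 3 := by
          by_contra h; simp [p6, coeff_X_pow, h] at hm
        subst this; omega
      · have : m = 6 ∨ m = 2 := by
          by_contra! h; simp [p7, coeff_X_pow, h.1, h.2] at hm
        rcases this with rfl | rfl <;> omega
    · obtain ⟨j, N', rfl, hlt⟩ := top N (by omega)
      have hq : 0 < 2 ^ j := by positivity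
      obtain ⟨n1, n2⟩ := g_nocarry g hg0 hge hgo j N' hlt
      have hc := codes j
      rw [frob P hrec, coeff_add, coeff_add] at hm
      have : (X ^ (8 * 2 ^ j) * P N').coeff m ≠ 0 ∨
          (X ^ (2 * 2 ^ j) * P (N' + 2 * 2 ^ j)).coeff m ≠ 0 ∨
          (X ^ (2 ^ j) * P (N' + 2 ^ j)).coeff m ≠ 0 := by
        by_contra! h
        simp [h.1, h.2.1, h.2.2] at hm
      unfold U at ih ⊢
      rw [n1, n2]
      rcases this with h | h | h
      · obtain ⟨m', rfl, hh⟩ := cf _ _ _ h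
        have a1 := ih N' (by omega) m' hh
        have a2 := sub m' (8 * 2 ^ j)
        omega
      · obtain ⟨m', rfl, hh⟩ := cf _ _ _ h
        have a1 := ih (N' + 2 * 2 ^ j) (by omega) m' hh
        have a2 := sub m' (2 * 2 ^ j)
        have a3 := sub N' (2 * 2 ^ j)
        obtain ⟨k, hc | hc⟩ := hc <;> omega
      · obtain ⟨m', rfl, hh⟩ := cf _ _ _ h
        have a1 := ih (N' + 2 ^ j) (by omega) m' hh
        have a2 := sub m' (2 ^ j)
        have a3 := sub N' (2 ^ j)
        obtain ⟨k, hc | hc⟩ := hc <;> omega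

theorem lower (g : ℕ → ℕ) (hg0 : g 0 = 0) (hge : ∀ n, g (2 * n) = 4 * g n)
    (hgo : ∀ n, g (2 * n + 1) = g (2 * n) + 1) (P : ℕ → Polynomial (ZMod 2))
    (p0 : P 0 = 0) (p1 : P 1 = 1) (p2 : P 2 = 0) (p3 : P 3 = X ^ 2) (p4 : P 4 = X)
    (p5 : P 5 = X ^ 4 + 1) (p6 : P 6 = X ^ 3) (p7 : P 7 = X ^ 6 + X ^ 2)
    (hrec : ∀ n, P (n + 8) = X ^ 8 * P n + X ^ 2 * P (n + 2) + X * P (n + 1)) (N : ℕ) :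
    0 < e N → (P N).coeff (g (e N - 1) + 2 * g (d N)) = 1 := by
  have up := upper g hg0 hge hgo P p0 p1 p2 p3 p4 p5 p6 p7 hrec
  induction N using Nat.strong_induction_on with
  | _ N ih =>
    intro hpos
    by_cases h8 : N < 8
    · obtain ⟨s1, s2, s3, s4, s5, s6, s7⟩ := small
      have g1 : g 1 = 1 := by have := hgo 0; simpa [hg0] using this
      have g2 : g 2 = 4 := by have := hge 1; simpa [g1] using this
      have z1 := e_zero
      interval_cases N
      · omega
      · simp [s1, hg0, p1]
      · omega
      · simp [s3, hg0, g1, p3]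
      · simp [s4, hg0, g1, p4]
      · simp [s5, hg0, g2, p5, coeff_one]
      · simp [s6, g1, p6]
      · simp [s7, g1, g2, p7, coeff_X_pow]
    · obtain ⟨j, N', rfl, hlt⟩ := top N (by omega)
      have hq : 0 < 2 ^ j := by positivity
      obtain ⟨n1, n2⟩ := g_nocarry g hg0 hge hgo j N' hlt
      have hc := codes j
      obtain ⟨M, hM⟩ : ∃ M, M = g (e (N' + 8 * 2 ^ j) - 1) + 2 * g (d (N' + 8 * 2 ^ j)) := ⟨_, rfl⟩
      have eM : e M = e (N' + 8 * 2 ^ j) - 1 := by rw [hM, e_g g hg0 hge hgo]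
      have dM : d M = d (N' + 8 * 2 ^ j) := by rw [hM, d_g g hg0 hge hgo]
      rw [← hM, frob P hrec, coeff_add, coeff_add]
      rw [n1] at hpos hM eM
      rw [n2] at hM dM
      have t3 : (X ^ (2 ^ j) * P (N' + 2 ^ j)).coeff M = 0 := by
        by_contra h
        obtain ⟨m', rfl, hh⟩ := cf _ _ _ h
        have a1 := up _ m' hh
        have a2 := sub m' (2 ^ j)
        have a3 := sub N' (2 ^ j)
        unfold U at a1
        obtain ⟨k, hc⟩ := hc
        have w : 0 < 2 ^ k := by positivity
        rcases hc with hc | hc <;> omega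
      rw [t3, add_zero]
      have hN := G1 g hg0 hge hgo N'
      by_cases ha : e N' = 0
      · have t1 : (X ^ (8 * 2 ^ j) * P N').coeff M = 0 := by
          by_contra h
          obtain ⟨m', rfl, hh⟩ := cf _ _ _ h
          have a1 := up _ m' hh
          have a2 := sub m' (8 * 2 ^ j)
          unfold U at a1
          omega
        rw [t1, zero_add]
        obtain ⟨k, hc | ⟨hq4, c1, c2, c3, c4, c5, c6⟩⟩ := hc
        · omega
        · have w : 0 < 2 ^ k := by positivity
          have f1 : 2 * 2 ^ j = 4 ^ (k + 1) := by rw [hq4]; ring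
          have f2 := g_pow g hg0 hge hgo (k + 1)
          have f3 : N' + 2 * 2 ^ j = g (2 ^ (k + 1)) + 2 * g (d N') := by
            rw [ha, hg0] at hN; omega
          have f4 := e_g g hg0 hge hgo (2 ^ (k + 1)) (d N')
          have f5 := d_g g hg0 hge hgo (2 ^ (k + 1)) (d N')
          rw [← f3] at f4 f5
          have f6 := ih (N' + 2 * 2 ^ j) (by omega) (by rw [f4]; positivity)
          rw [f4, f5] at f6
          have f7 := g_pow_add g hg0 hge hgo (k + 1) (2 ^ (k + 1) - 1)
            (by rw [pow_succ]; omega)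
          have f8 : e N' + e (8 * 2 ^ j) - 1 = 2 ^ (k + 1) + (2 ^ (k + 1) - 1) := by
            rw [pow_succ]; omega
          rw [f8, f7, c6, add_zero] at hM
          have f9 : M = g (2 ^ (k + 1) - 1) + 2 * g (d N') + 2 * 2 ^ j := by omega
          rw [f9, coeff_X_pow_mul, f6]
      · have t2 : (X ^ (2 * 2 ^ j) * P (N' + 2 * 2 ^ j)).coeff M = 0 := by
          by_contra h
          obtain ⟨m', hm', h⟩ := cf _ _ _ h
          have a1 := up _ m' h
          have a2 := sub m' (2 * 2 ^ j)
          have a3 := sub N' (2 * 2 ^ j)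
          rw [← hm'] at a2
          unfold U at a1
          have k1 := G1 g hg0 hge hgo m'
          have k2 := G1 g hg0 hge hgo (N' + 2 * 2 ^ j)
          obtain ⟨k, ⟨hq4, c1, c2, c3, c4, c5, c6⟩ | ⟨hq4, c1, c2, c3, c4, c5, c6⟩⟩ := hc
          · have r1 : e (N' + 2 * 2 ^ j) = e N' := by omega
            have r2 : d (N' + 2 * 2 ^ j) = d N' + 2 ^ k := by omega
            have r3 : e m' = e N' - 1 := by omega
            have r4 : d m' = d N' + 2 ^ k := by omega
            have hb : d N' < 2 ^ (k + 1) := by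
              have h8 : 8 * 2 ^ j = 2 * 4 ^ (k + 1) := by rw [hq4]; ring
              exact e_lt _ _ (by omega)
            rw [r1, r2] at k2
            rw [r3, r4] at k1
            rw [c5, c6, add_zero] at hM
            refine carry g hg0 hge hgo k (d N') (d N') le_rfl (by rw [pow_succ] at hb; omega) ?_ ?_
            · omega
            · omega
          · have r1 : e (N' + 2 * 2 ^ j) = e N' + 2 * 2 ^ k := by omega
            have r2 : d (N' + 2 * 2 ^ j) = d N' := by omega
            have r3 : e m' = e N' - 1 + 2 * 2 ^ k := by omega
            have r4 : d m' = d N' := by omega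
            have hb : e N' < 2 ^ (k + 2) := by
              have h8 : 8 * 2 ^ j = 4 ^ (k + 2) := by rw [hq4]; ring
              exact e_lt _ _ (by omega)
            have f1 : 2 * 2 ^ j = 4 ^ (k + 1) := by rw [hq4]; ring
            have e1 : 2 * 2 ^ k = 2 ^ (k + 1) := by ring
            have e2 : e N' + e (8 * 2 ^ j) - 1 = e N' - 1 + 2 * 2 ^ (k + 1) := by
              rw [c5, ← e1]; omega
            rw [r1, r2, e1] at k2
            rw [r3, r4, e1] at k1
            rw [e2, c6, add_zero] at hM
            refine carry g hg0 hge hgo (k + 1) (e N') (e N' - 1) (by omega)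
              (by rw [pow_succ] at hb; omega) ?_ ?_
            · omega
            · omega
        rw [t2, add_zero]
        have f6 := ih N' (by omega) (by omega)
        have f9 : M = g (e N' - 1) + 2 * g (d N') + 8 * 2 ^ j := by
          obtain ⟨l1, l2⟩ := g_nocarry g hg0 hge hgo j (g (e N' - 1) + 2 * g (d N')) (by
            have hmono := g_mono g hge hgo (e N' - 1)
            rw [Nat.sub_add_cancel (by omega)] at hmono
            omega)
          rw [e_g g hg0 hge hgo] at l1
          rw [d_g g hg0 hge hgo] at l2
          have k1 := G1 g hg0 hge hgo (g (e N' - 1) + 2 * g (d N') + 8 * 2 ^ j)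
          rw [l1, l2] at k1
          have : e N' + e (8 * 2 ^ j) - 1 = e N' - 1 + e (8 * 2 ^ j) := by omega
          rw [hM, this, ← k1]
        rw [f9, coeff_X_pow_mul, f6]

/-- The square-root polynomials: `A (2N+1) = X * (P N)^2`. -/
noncomputable def P : ℕ → Polynomial (ZMod 2)
  | 0 => 0
  | 1 => 1
  | 2 => 0
  | 3 => X ^ 2
  | 4 => X
  | 5 => X ^ 4 + 1
  | 6 => X ^ 3
  | 7 => X ^ 6 + X ^ 2
  | n + 8 => X ^ 8 * P n + X ^ 2 * P (n + 2) + X * P (n + 1)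

theorem coeff_sq (f : Polynomial (ZMod 2)) (m : ℕ) :
    (X * f ^ 2).coeff (2 * m + 1) = f.coeff m := by
  rw [coeff_X_mul, ← ZMod.expand_card, mul_comm 2 m, coeff_expand_mul (by norm_num)]

theorem coeff_sq_ne (f : Polynomial (ZMod 2)) (n : ℕ) (h : (X * f ^ 2).coeff n ≠ 0) :
    ∃ m, n = 2 * m + 1 ∧ f.coeff m ≠ 0 := by
  rcases n with _ | n
  · simp at h
  · rw [coeff_X_mul, ← ZMod.expand_card, coeff_expand (by norm_num)] at h
    split_ifs at h with hd
    · exact ⟨n / 2, by omega, h⟩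
    · exact absurd rfl h

end NS

theorem stmt_16 (g : ℕ → ℕ) (hg0 : g 0 = 0)
    (hge : ∀ n, g (2 * n) = 4 * g n)
    (hgo : ∀ n, g (2 * n + 1) = g (2 * n) + 1)
    (A : ℕ → Polynomial (ZMod 2))
    (h1 : A 1 = 0) (h3 : A 3 = X) (h5 : A 5 = 0) (h7 : A 7 = X ^ 5)
    (h9 : A 9 = X ^ 3) (h11 : A 11 = X ^ 9 + X) (h13 : A 13 = X ^ 7)
    (h15 : A 15 = X ^ 13 + X ^ 5)
    (hrec : ∀ n, Odd n → A (n + 16) =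
      X ^ 16 * A n + X ^ 4 * A (n + 4) + X ^ 2 * A (n + 2)) :
    ∀ n, Odd n → 0 < n → ∀ a b, n = 1 + 2 * g a + 4 * g b →
      (0 < a → ∃ B : Polynomial (ZMod 2),
        A n = X ^ (1 + 2 * g (a - 1) + 4 * g b) + B ∧
        ∀ m, B.coeff m ≠ 0 → ∃ c d, m = 1 + 2 * g c + 4 * g d ∧ prec c d (a - 1) b) ∧
      (a = 0 → ∀ m, (A n).coeff m ≠ 0 →
        ∃ c d, m = 1 + 2 * g c + 4 * g d ∧ ((c, d) = (0, b - 1) ∨ prec c d 0 (b - 1))) := by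
  have hA : ∀ N, A (2 * N + 1) = X * NS.P N ^ 2 := by
    intro N
    induction N using Nat.strong_induction_on with
    | _ N ih =>
      by_cases h8 : N < 8
      · interval_cases N
        · simp [NS.P, h1]
        · simp [NS.P, h3]
        · simp [NS.P, h5]
        · simp only [NS.P, Nat.reduceMul, Nat.reduceAdd, h7]; ring
        · simp only [NS.P, Nat.reduceMul, Nat.reduceAdd, h9]; ring
        · simp only [NS.P, Nat.reduceMul, Nat.reduceAdd, h11, CharTwo.add_sq]; ring
        · simp only [NS.P, Nat.reduceMul, Nat.reduceAdd, h13]; ring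
        · simp only [NS.P, Nat.reduceMul, Nat.reduceAdd, h15, CharTwo.add_sq]; ring
      · obtain ⟨n, rfl⟩ : ∃ n, N = n + 8 := ⟨N - 8, by omega⟩
        have e0 : 2 * (n + 8) + 1 = 2 * n + 1 + 16 := by ring
        have e1 : 2 * n + 1 + 4 = 2 * (n + 2) + 1 := by ring
        have e2 : 2 * n + 1 + 2 = 2 * (n + 1) + 1 := by ring
        rw [e0, hrec _ ⟨n, rfl⟩, e1, e2, ih n (by omega), ih (n + 2) (by omega),
          ih (n + 1) (by omega), NS.P, CharTwo.add_sq, CharTwo.add_sq]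
        ring
  have up := NS.upper g hg0 hge hgo NS.P (by rw [NS.P]) (by rw [NS.P]) (by rw [NS.P])
    (by rw [NS.P]) (by rw [NS.P]) (by rw [NS.P]) (by rw [NS.P]) (by rw [NS.P])
    (fun n => by rw [NS.P])
  have lo := NS.lower g hg0 hge hgo NS.P (by rw [NS.P]) (by rw [NS.P]) (by rw [NS.P])
    (by rw [NS.P]) (by rw [NS.P]) (by rw [NS.P]) (by rw [NS.P]) (by rw [NS.P])
    (fun n => by rw [NS.P])
  intro n _ _ a b hn
  have hn' : n = 2 * (g a + 2 * g b) + 1 := by omega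
  have ea := NS.e_g g hg0 hge hgo a b
  have db := NS.d_g g hg0 hge hgo a b
  constructor
  · intro ha
    have lead := lo (g a + 2 * g b) (by omega)
    rw [ea, db] at lead
    refine ⟨A n - X ^ (1 + 2 * g (a - 1) + 4 * g b), by ring, ?_⟩
    intro m hm
    rw [hn', hA, coeff_sub, coeff_X_pow] at hm
    have hM : 1 + 2 * g (a - 1) + 4 * g b = 2 * (g (a - 1) + 2 * g b) + 1 := by ring
    rw [hM] at hm
    by_cases hmM : m = 2 * (g (a - 1) + 2 * g b) + 1
    · rw [hmM, NS.coeff_sq, lead] at hm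
      simp at hm
    · rw [if_neg hmM, sub_zero] at hm
      obtain ⟨k, rfl, hk⟩ := NS.coeff_sq_ne _ _ hm
      have hu := up _ k hk
      have k1 := NS.G1 g hg0 hge hgo k
      unfold NS.U at hu
      rw [ea, db] at hu
      refine ⟨NS.e k, NS.d k, by omega, ?_⟩
      unfold prec
      by_contra hcon
      have r1 : NS.d k = b := by omega
      have r2 : NS.e k = a - 1 := by omega
      rw [r1, r2] at k1
      omega
  · rintro rfl m hm
    rw [hn', hA] at hm
    obtain ⟨k, rfl, hk⟩ := NS.coeff_sq_ne _ _ hm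
    have hu := up _ k hk
    have k1 := NS.G1 g hg0 hge hgo k
    unfold NS.U at hu
    rw [ea, db] at hu
    refine ⟨NS.e k, NS.d k, by omega, ?_⟩
    unfold prec
    rw [Prod.mk.injEq]
    omega
end
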